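/- For all integers k ≥ 1 and n ≥ 0, Σ_w e(w)² = k^n · n!, where the sum is over all words w of rank n in the Fibonacci poset Z(k) and e(w) denotes the number of saturated chains from the empty word ∅ to w in Z(k). -/

import Mathlib

namespace KRF

/-- A letter of the alphabet `{1_1, …, 1_k, 2}`:  `one j` stands for the letter `1_j`
(with `1 ≤ j ≤ k` for genuine letters), and `two` stands for the letter `2`. -/
inductive Letter (k : ℕ) : Type where
  | one : ℕ → Letter k
  | two : Letter k
deriving DecidableEq

/-- A word over the alphabet `{1_1, …, 1_k, 2}`, listed from the leftmost letter to the
rightmost letter. -/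
abbrev Word (k : ℕ) := List (Letter k)

/-- The contribution of a letter to the rank: each `1_j` counts `1` and each `2` counts `2`. -/
def Letter.rank {k : ℕ} : Letter k → ℕ
  | .one _ => 1
  | .two => 2

/-- The rank of a word: the sum of its letters. -/
def Word.rank {k : ℕ} (w : Word k) : ℕ := (w.map Letter.rank).sum

/-- The letter `1_j` is valid when `1 ≤ j ≤ k`. -/
def Letter.Valid (k : ℕ) : Letter k → Prop
  | .one j => 1 ≤ j ∧ j ≤ k
  | .two => True

/-- A genuine word of the Fibonacci poset `Z(k)`: all of its letters are valid. -/
def Word.Valid (k : ℕ) (w : Word k) : Prop := ∀ l ∈ w, l.Valid k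

/-- The cover relation of the Fibonacci poset `Z(k)`:  `z` is covered by `w` iff `z` is
obtained from `w` either by changing a `2` into some `1_j` when all letters to the left of
that `2` are `2`'s, or by deleting the leftmost letter of the form `1_j`. -/
def ZCovers (k : ℕ) (z w : Word k) : Prop :=
  (∃ (p s : Word k) (j : ℕ), (∀ l ∈ p, l = Letter.two) ∧ 1 ≤ j ∧ j ≤ k ∧
      w = p ++ Letter.two :: s ∧ z = p ++ Letter.one j :: s) ∨
  (∃ (p s : Word k) (j : ℕ), (∀ l ∈ p, l = Letter.two) ∧ 1 ≤ j ∧ j ≤ k ∧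
      w = p ++ Letter.one j :: s ∧ z = p ++ s)

/-- `c 0 ⋖ c 1 ⋖ ⋯ ⋖ c n` is a saturated chain in `Z(k)` starting at the empty word. -/
def IsZChain (k n : ℕ) (c : ℕ → Word k) : Prop :=
  c 0 = [] ∧ ∀ i, i < n → ZCovers k (c i) (c (i + 1))

end KRF
namespace KRF

/-- `e(w)`: the number of saturated chains `∅ = c 0 ⋖ c 1 ⋖ ⋯ ⋖ c n = w` in `Z(k)`. -/
noncomputable def chainCount (k n : ℕ) (w : Word k) : ℕ :=
  Nat.card {c : Fin (n + 1) → Word k //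
    c 0 = [] ∧ (∀ i : Fin n, ZCovers k (c i.castSucc) (c i.succ)) ∧ c (Fin.last n) = w}

end KRF
namespace KRF

/-- The finset of words covered by `w`. -/
def dn (k : ℕ) : Word k → Finset (Word k)
  | [] => ∅
  | .one _ :: s => {s}
  | .two :: s => (Finset.Icc 1 k).image (fun j => Letter.one j :: s) ∪
      (dn k s).image (fun z => Letter.two :: z)

/-- The product formula for the number of chains. -/
def pf (k : ℕ) : Word k → ℕ
  | [] => 1
  | .one _ :: s => pf k s
  | .two :: s => k * (Word.rank s + 1) * pf k s

/-- The finset of words of rank `n`. -/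
def wds (k : ℕ) : ℕ → Finset (Word k)
  | 0 => {[]}
  | 1 => (Finset.Icc 1 k ×ˢ {[]}).image (fun p => Letter.one p.1 :: p.2)
  | n + 2 => (Finset.Icc 1 k ×ˢ wds k (n + 1)).image (fun p => Letter.one p.1 :: p.2) ∪
      (wds k n).image (fun z => Letter.two :: z)

@[simp] lemma rank_nil (k : ℕ) : Word.rank ([] : Word k) = 0 := rfl
@[simp] lemma rank_one (k j : ℕ) (s : Word k) :
    Word.rank (Letter.one j :: s) = Word.rank s + 1 := by
  simp [Word.rank, Letter.rank, add_comm]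
@[simp] lemma rank_two (k : ℕ) (s : Word k) :
    Word.rank (Letter.two :: s) = Word.rank s + 2 := by
  simp [Word.rank, Letter.rank, add_comm]
@[simp] lemma valid_nil (k : ℕ) : Word.Valid k [] := by simp [Word.Valid]
@[simp] lemma valid_one (k j : ℕ) (s : Word k) :
    Word.Valid k (Letter.one j :: s) ↔ (1 ≤ j ∧ j ≤ k) ∧ Word.Valid k s := by
  simp [Word.Valid, Letter.Valid]
@[simp] lemma valid_two (k : ℕ) (s : Word k) :
    Word.Valid k (Letter.two :: s) ↔ Word.Valid k s := by
  simp [Word.Valid, Letter.Valid]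

lemma cov_nil (k : ℕ) (z : Word k) : ¬ ZCovers k z [] := by
  rintro (⟨p, s, j, _, _, _, h, _⟩ | ⟨p, s, j, _, _, _, h, _⟩) <;> simp at h

lemma cov_one (k j : ℕ) (z s : Word k) :
    ZCovers k z (Letter.one j :: s) ↔ (1 ≤ j ∧ j ≤ k) ∧ z = s := by
  constructor
  · rintro (⟨p, t, i, hp, h1, h2, h, hz⟩ | ⟨p, t, i, hp, h1, h2, h, hz⟩)
    · cases p with
      | nil => simp at h
      | cons a p => 
        have := hp a (by simp)
        simp_all
    · cases p with
      | nil => simp at h hz; obtain ⟨rfl, rfl⟩ := h; exact ⟨⟨h1, h2⟩, hz⟩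
      | cons a p => 
        have := hp a (by simp)
        simp_all
  · rintro ⟨⟨h1, h2⟩, rfl⟩
    exact Or.inr ⟨[], z, j, by simp, h1, h2, rfl, rfl⟩

lemma cov_two (k : ℕ) (z s : Word k) :
    ZCovers k z (Letter.two :: s) ↔ (∃ j, (1 ≤ j ∧ j ≤ k) ∧ Letter.one j :: s = z) ∨
      ∃ y, ZCovers k y s ∧ Letter.two :: y = z := by
  constructor
  · rintro (⟨p, t, i, hp, h1, h2, h, hz⟩ | ⟨p, t, i, hp, h1, h2, h, hz⟩)
    · cases p with
      | nil => 
        simp at h hz; subst h; exact Or.inl ⟨i, ⟨h1, h2⟩, hz.symm⟩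
      | cons a p => 
        have ha := hp a (by simp)
        subst ha
        simp at h
        exact Or.inr ⟨p ++ Letter.one i :: t, 
          Or.inl ⟨p, t, i, fun l hl => hp l (by simp [hl]), h1, h2, h, rfl⟩, by simp [hz]⟩
    · cases p with
      | nil => simp at h
      | cons a p => 
        have ha := hp a (by simp)
        subst ha
        simp at h
        exact Or.inr ⟨p ++ t, 
          Or.inr ⟨p, t, i, fun l hl => hp l (by simp [hl]), h1, h2, h, rfl⟩, by simp [hz]⟩
  · rintro (⟨j, ⟨h1, h2⟩, rfl⟩ | ⟨y, (⟨p, t, i, hp, h1, h2, rfl, rfl⟩ | ⟨p, t, i, hp, h1, h2, rfl, rfl⟩), rfl⟩)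
    · exact Or.inl ⟨[], s, j, by simp, h1, h2, rfl, rfl⟩
    · exact Or.inl ⟨Letter.two :: p, t, i, by simpa using hp, h1, h2, rfl, rfl⟩
    · exact Or.inr ⟨Letter.two :: p, t, i, by simpa using hp, h1, h2, rfl, rfl⟩

lemma mem_dn (k : ℕ) (w : Word k) (hw : Word.Valid k w) (z : Word k) :
    z ∈ dn k w ↔ ZCovers k z w := by
  induction w generalizing z with
  | nil => simp [dn, cov_nil]
  | cons a s ih =>
    cases a with
    | one j =>
      rw [valid_one] at hw
      simp [dn, cov_one, hw.1]
    | two =>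
      rw [valid_two] at hw
      simp [dn, cov_two, ih hw]

lemma dn_valid (k : ℕ) (w : Word k) (hw : Word.Valid k w) (z : Word k) (hz : z ∈ dn k w) :
    Word.Valid k z ∧ Word.rank z + 1 = Word.rank w := by
  induction w generalizing z with
  | nil => simp [dn] at hz
  | cons a s ih =>
    cases a with
    | one j =>
      simp [dn] at hz hw
      simp [hz, hw]
    | two =>
      simp [dn] at hz hw
      rcases hz with ⟨j, hj, rfl⟩ | ⟨y, hy, rfl⟩
      · simp [hj, hw]
      · have := ih hw y hy
        simp [this.1, ← this.2]

lemma sum_dn (k : ℕ) (w : Word k) (hw : Word.Valid k w) (hne : w ≠ []) :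
    ∑ z ∈ dn k w, pf k z = pf k w := by
  induction w with
  | nil => simp at hne
  | cons a s ih =>
    cases a with
    | one j => simp [dn, pf]
    | two =>
      rw [valid_two] at hw
      rw [dn, Finset.sum_union, Finset.sum_image, Finset.sum_image]
      · simp only [pf, Finset.sum_const, Nat.card_Icc]
        have h : ∀ z ∈ dn k s, k * (Word.rank z + 1) * pf k z = k * Word.rank s * pf k z := by
          intro z hz
          rw [(dn_valid k s hw z hz).2]
        rw [Finset.sum_congr rfl h, ← Finset.mul_sum]
        by_cases hs : s = []
        · subst hs; simp [dn, pf]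
        · rw [ih hw hs]; simp; ring
      · intro x _ y _ h; simpa using h
      · intro x _ y _ h; simpa using h
      · rw [Finset.disjoint_left]
        intro x hx hy
        simp at hx hy
        obtain ⟨j, _, rfl⟩ := hx
        simp at hy

/-- The type of chains. -/
abbrev Ch (k n : ℕ) (w : Word k) := {c : Fin (n + 1) → Word k //
    c 0 = [] ∧ (∀ i : Fin n, ZCovers k (c i.castSucc) (c i.succ)) ∧ c (Fin.last n) = w}

/-- Splitting off the last step of a chain. -/
def chEquiv (k n : ℕ) (w : Word k) (hw : Word.Valid k w) :
    Ch k (n + 1) w ≃ Σ z : dn k w, Ch k n z where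
  toFun c := ⟨⟨c.1 (Fin.last n).castSucc, by
      rw [mem_dn k w hw]
      have h := c.2.2.1 (Fin.last n)
      rw [Fin.succ_last, c.2.2.2] at h
      exact h⟩, 
    ⟨fun i => c.1 i.castSucc, c.2.1, fun i => c.2.2.1 i.castSucc, rfl⟩⟩
  invFun p := ⟨Fin.snoc (α := fun _ => Word k) p.2.1 w, by
    obtain ⟨⟨z, hz⟩, c, h0, h1, h2⟩ := p
    refine ⟨?_, ?_, ?_⟩
    · exact (Fin.snoc_castSucc (α := fun _ => Word k) w c 0).trans h0
    · intro i
      rw [Fin.snoc_castSucc]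
      refine Fin.lastCases ?_ (fun i => ?_) i
      · rw [Fin.succ_last, Fin.snoc_last]
        simp only [h2]
        exact (mem_dn k w hw z).1 hz
      · rw [Fin.succ_castSucc, Fin.snoc_castSucc]
        exact h1 i
    · rw [Fin.snoc_last]⟩
  left_inv c := by
    obtain ⟨c, h0, h1, h2⟩ := c
    apply Subtype.ext
    funext i
    refine Fin.lastCases ?_ (fun i => ?_) i
    · simp [h2]
    · simp
  right_inv p := by
    obtain ⟨⟨z, hz⟩, c, hc⟩ := p
    have e : c (Fin.last n) = z := hc.2.2
    subst e
    simp
    rw [Subtype.heq_iff_coe_eq]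
    intro x
    simp

lemma ch_card (k n : ℕ) (w : Word k) (hw : Word.Valid k w) (hr : Word.rank w = n) :
    Finite (Ch k n w) ∧ Nat.card (Ch k n w) = pf k w := by
  induction n generalizing w with
  | zero =>
    have : w = [] := by
      cases w with
      | nil => rfl
      | cons a s => cases a <;> simp at hr
    subst this
    have : Unique (Ch k 0 []) := 
      { default := ⟨fun _ => [], rfl, fun i => i.elim0, rfl⟩
        uniq := by
          rintro ⟨c, h0, h1, h2⟩
          apply Subtype.ext
          funext i
          have hi : i = 0 := by ext; omega
          subst hi
          exact h0 }
    exact ⟨inferInstance, by simp [pf]⟩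
  | succ n ih =>
    have key : ∀ z : dn k w, Finite (Ch k n z) ∧ Nat.card (Ch k n z) = pf k z := by
      rintro ⟨z, hz⟩
      have := dn_valid k w hw z hz
      exact ih z this.1 (by omega)
    have := fun z => (key z).1
    refine ⟨Finite.of_equiv _ (chEquiv k n w hw).symm, ?_⟩
    rw [Nat.card_congr (chEquiv k n w hw), Nat.card_sigma, ← sum_dn k w hw]
    · rw [← Finset.sum_coe_sort (dn k w)]
      exact Finset.sum_congr rfl fun z _ => (key z).2
    · rintro rfl; simp at hr

lemma mem_wds (k n : ℕ) (w : Word k) : 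
    w ∈ wds k n ↔ Word.Valid k w ∧ Word.rank w = n := by
  induction w generalizing n with
  | nil => 
    match n with
    | 0 => simp [wds]
    | 1 => simp [wds]
    | n + 2 => simp [wds]
  | cons a s ih =>
    have h0 : s = [] ↔ Word.Valid k s ∧ Word.rank s = 0 := by rw [← ih 0]; simp [wds]
    match a, n with
    | .one j, 0 => simp [wds]
    | .one j, 1 => simp [wds, h0, and_assoc]
    | .one j, n + 2 => simp [wds, ih, and_assoc]
    | .two, 0 => simp [wds]
    | .two, 1 => simp [wds]
    | .two, n + 2 => simp [wds, ih]

lemma sum_one (k : ℕ) (S : Finset (Word k)) :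
    ∑ w ∈ (Finset.Icc 1 k ×ˢ S).image (fun p => (Letter.one p.1 :: p.2 : Word k)), pf k w ^ 2
      = k * ∑ w ∈ S, pf k w ^ 2 := by
  rw [Finset.sum_image, Finset.sum_product]
  · simp [pf]
  · rintro ⟨a, b⟩ _ ⟨c, d⟩ _ h; simpa using h

lemma sum_wds (k n : ℕ) : ∑ w ∈ wds k n, pf k w ^ 2 = k ^ n * n.factorial := by
  induction n using Nat.twoStepInduction with
  | zero => simp [wds, pf]
  | one => rw [wds, sum_one]; simp [pf]
  | more n h0 h1 =>
    rw [wds, Finset.sum_union, sum_one, h1, Finset.sum_image]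
    · have h : ∀ z ∈ wds k n, pf k (Letter.two :: z) ^ 2 = (k * (n + 1)) ^ 2 * pf k z ^ 2 := by
        intro z hz
        rw [pf, ((mem_wds k n z).1 hz).2]; ring
      rw [Finset.sum_congr rfl h, ← Finset.mul_sum, h0]
      simp only [Nat.factorial_succ]
      ring
    · intro x _ y _ h; simpa using h
    · rw [Finset.disjoint_left]
      intro x hx hy
      simp at hx hy
      obtain ⟨j, _, _, _, rfl⟩ := hx
      simp at hy

/-- For all `k ≥ 1` and `n ≥ 0`,  `Σ_w e(w)² = kⁿ · n!`, where the sum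
ranges over all words `w` of rank `n` in the Fibonacci poset `Z(k)` and `e(w)` is the
number of saturated chains from the empty word to `w` in `Z(k)`. -/
theorem sum_chainCount_sq (k n : ℕ) (hk : 1 ≤ k) :
    ∑ᶠ w ∈ {w : Word k | Word.Valid k w ∧ Word.rank w = n}, (chainCount k n w) ^ 2 =
      k ^ n * n.factorial := by
  have hS : {w : Word k | Word.Valid k w ∧ Word.rank w = n} = ↑(wds k n) := by
    ext w; simp [mem_wds]
  rw [hS, finsum_mem_coe_finset, ← sum_wds]
  refine Finset.sum_congr rfl fun w hw => ?_
  have := (mem_wds k n w).1 hw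
  rw [← (ch_card k n w this.1 this.2).2]
  rfl

end KRF
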